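/- If α ∈ (0, 1/2), so that L = log((1−α)/α) > 0, then f''(u) > 0 for every u in the closed interval [0, L]; i.e., the practical optimization interval from the model initialization u = 0 to the optimum u = log((1−α)/α) lies entirely within the region where f is strictly convex. -/

import Mathlib

/-- The logistic sigmoid σ(u) = 1/(1+exp(−u)). -/
noncomputable def sigmoid (u : ℝ) : ℝ := 1 / (1 + Real.exp (-u))

/-- L := log((1−α)/α). -/
noncomputable def L (α : ℝ) : ℝ := Real.log ((1 - α) / α)

/-- f(u) := σ(u)·log(σ(u)/(1−α)) + σ(−u)·log(σ(−u)/α). -/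
noncomputable def f (α : ℝ) (u : ℝ) : ℝ :=
  sigmoid u * Real.log (sigmoid u / (1 - α)) + sigmoid (-u) * Real.log (sigmoid (-u) / α)

/-- g(u) := −u·exp(u) + (L+1)·exp(u) + u + 1 − L. -/
noncomputable def g (α : ℝ) (u : ℝ) : ℝ :=
  -u * Real.exp u + (L α + 1) * Real.exp u + u + 1 - L α

theorem sigmoid_eq_exp_div (u : ℝ) : sigmoid u = Real.exp u / (1 + Real.exp u) := by
  have h := Real.exp_pos u
  rw [sigmoid, Real.exp_neg]
  field_simp
  ring

theorem sigmoid_neg_eq (u : ℝ) : sigmoid (-u) = 1 / (1 + Real.exp u) := by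
  rw [sigmoid, neg_neg]

theorem f_eq {α : ℝ} (h0 : 0 < α) (h1 : α < 1) (u : ℝ) :
    f α u = Real.exp u / (1 + Real.exp u) * (u - L α) - Real.log α
      - Real.log (1 + Real.exp u) := by
  have he := Real.exp_pos u
  have h1' : 0 < 1 - α := sub_pos.2 h1
  have hd : 0 < 1 + Real.exp u := by positivity
  rw [f, sigmoid_eq_exp_div, sigmoid_neg_eq, L, Real.log_div h1'.ne' h0.ne',
    Real.log_div (by positivity) h1'.ne', Real.log_div (by positivity) h0.ne',
    Real.log_div he.ne' hd.ne', Real.log_div one_ne_zero hd.ne', Real.log_exp, Real.log_one]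
  field_simp
  ring

theorem hasDerivAt_one_add_exp (u : ℝ) :
    HasDerivAt (fun x => 1 + Real.exp x) (Real.exp u) u :=
  (Real.hasDerivAt_exp u).const_add 1

theorem hasDerivAt_f {α : ℝ} (h0 : 0 < α) (h1 : α < 1) (u : ℝ) :
    HasDerivAt (f α) (Real.exp u / (1 + Real.exp u) ^ 2 * (u - L α)) u := by
  have hd : 1 + Real.exp u ≠ 0 := by positivity
  have h := ((((Real.hasDerivAt_exp u).fun_div (hasDerivAt_one_add_exp u) hd).fun_mul
    ((hasDerivAt_id' u).sub_const (L α))).sub_const (Real.log α)).fun_sub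
    ((hasDerivAt_one_add_exp u).log hd)
  rw [funext (f_eq h0 h1)]
  refine h.congr_deriv ?_
  field_simp
  ring

theorem deriv_deriv_f {α : ℝ} (h0 : 0 < α) (h1 : α < 1) (u : ℝ) :
    deriv (deriv (f α)) u = Real.exp u / (1 + Real.exp u) ^ 3 * g α u := by
  have hd : 1 + Real.exp u ≠ 0 := by positivity
  rw [funext fun x => (hasDerivAt_f h0 h1 x).deriv]
  have h := ((Real.hasDerivAt_exp u).fun_div ((hasDerivAt_one_add_exp u).fun_pow 2)
    (pow_ne_zero 2 hd)).fun_mul ((hasDerivAt_id' u).sub_const (L α))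
  rw [h.deriv, g]
  field_simp
  ring

theorem g_pos {α u : ℝ} (hu : u ∈ Set.Icc 0 (L α)) : 0 < g α u := by
  have h1 := Real.one_le_exp hu.1
  have h2 := mul_nonneg (sub_nonneg.2 h1) (sub_nonneg.2 hu.2)
  rw [g]
  linarith

theorem stmt_13 (α : ℝ) (hα : α ∈ Set.Ioo (0 : ℝ) (1 / 2)) :
    0 < L α ∧ ∀ u ∈ Set.Icc (0 : ℝ) (L α), 0 < deriv (deriv (f α)) u := by
  obtain ⟨h0, h2⟩ := hα
  have h1 : α < 1 := by linarith
  refine ⟨Real.log_pos ((one_lt_div h0).2 (by linarith)), fun u hu => ?_⟩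
  rw [deriv_deriv_f h0 h1]
  have hg := g_pos hu
  positivity
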